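/- arXiv:2502.07739 — 2 statements merged into one kernel-verified Lean document; each statement's English description precedes it below -/
import Mathlib

section
/- Consider classic LoRA gradient flow (η_A = η_B = η) for matrix factorization. Suppose for some index i ≤ r the initialization satisfies A_0ᵀ v_i(M) = 0 and B_0ᵀ u_i(M) = 0. Then for all t ≥ 0, X_t v_i(M) = 0 and u_i(M)ᵀ X_t = 0; consequently, if in addition σ_i(M) > σ_{r+1}(M), then for all t ≥ 0, L_t − L* ≥ (1/2)(σ_i(M)² − σ_{r+1}(M)²) > 0. -/
open Matrix MeasureTheory Filter Topology

noncomputable section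

/-- The measurable space structure on matrices (the product σ-algebra). -/
instance matrixMeasurableSpace {m n : Type*} : MeasurableSpace (Matrix m n ℝ) :=
  show MeasurableSpace (m → n → ℝ) from inferInstance

/-- Squared Frobenius norm of a real matrix. -/
def fnormSq {m n : ℕ} (M : Matrix (Fin m) (Fin n) ℝ) : ℝ := ∑ i, ∑ j, M i j ^ 2

/-- Frobenius norm of a real matrix. -/
def fnorm {m n : ℕ} (M : Matrix (Fin m) (Fin n) ℝ) : ℝ := Real.sqrt (fnormSq M)

/-- `X = (α/r) • B Aᵀ`, the LoRA update associated with adapters `A`, `B`. -/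
def lX {a b r : ℕ} (α : ℝ) (A : Matrix (Fin a) (Fin r) ℝ) (B : Matrix (Fin b) (Fin r) ℝ) :
    Matrix (Fin b) (Fin a) ℝ := (α / (r : ℝ)) • (B * Aᵀ)

/-- `Y = (α/r) • A Aᵀ`. -/
def lY {a r : ℕ} (α : ℝ) (A : Matrix (Fin a) (Fin r) ℝ) : Matrix (Fin a) (Fin a) ℝ :=
  (α / (r : ℝ)) • (A * Aᵀ)

/-- `Z = (α/r) • B Bᵀ`. -/
def lZ {b r : ℕ} (α : ℝ) (B : Matrix (Fin b) (Fin r) ℝ) : Matrix (Fin b) (Fin b) ℝ :=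
  (α / (r : ℝ)) • (B * Bᵀ)

/-- `G = (α/r) • (X - M)`, the gradient of the matrix-factorization loss. -/
def lG {a b r : ℕ} (α : ℝ) (M : Matrix (Fin b) (Fin a) ℝ) (A : Matrix (Fin a) (Fin r) ℝ)
    (B : Matrix (Fin b) (Fin r) ℝ) : Matrix (Fin b) (Fin a) ℝ :=
  (α / (r : ℝ)) • (lX α A B - M)

/-- The LoRA gradient flow on `[0, ∞)` for the matrix-factorization objective, with learning
rates `ηA` for the adapter `A` and `ηB` for the adapter `B`:
`dA/dt = -ηA Gᵀ B`, `dB/dt = -ηB G A`, stated entrywise. -/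
def LoraFlow {a b r : ℕ} (α ηA ηB : ℝ) (M : Matrix (Fin b) (Fin a) ℝ)
    (A : ℝ → Matrix (Fin a) (Fin r) ℝ) (B : ℝ → Matrix (Fin b) (Fin r) ℝ) : Prop :=
  ∀ t, (0 : ℝ) ≤ t →
    (∀ i j, HasDerivAt (fun s => A s i j) (((-ηA) • ((lG α M (A t) (B t))ᵀ * B t)) i j) t) ∧
    (∀ i j, HasDerivAt (fun s => B s i j) (((-ηB) • (lG α M (A t) (B t) * A t)) i j) t)

/-- The rectangular `b × a` diagonal matrix with diagonal entries `σ 0, σ 1, …`. -/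
def svdDiag (b a : ℕ) (σ : ℕ → ℝ) : Matrix (Fin b) (Fin a) ℝ :=
  Matrix.of fun i j => if (i : ℕ) = (j : ℕ) then σ (i : ℕ) else 0

/-- `M = U Σ Vᵀ` is a singular value decomposition of `M` with (nonincreasing, nonnegative)
singular values `σ 0 ≥ σ 1 ≥ …`, so that `σ i` is the `(i+1)`-th largest singular value,
the columns of `U` are corresponding left singular vectors and the columns of `V` are
corresponding right singular vectors. -/
def IsSVD {b a : ℕ} (M : Matrix (Fin b) (Fin a) ℝ) (U : Matrix (Fin b) (Fin b) ℝ)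
    (V : Matrix (Fin a) (Fin a) ℝ) (σ : ℕ → ℝ) : Prop :=
  U * Uᵀ = 1 ∧ Uᵀ * U = 1 ∧ V * Vᵀ = 1 ∧ Vᵀ * V = 1 ∧
    (∀ i j, i ≤ j → σ j ≤ σ i) ∧ (∀ i, 0 ≤ σ i) ∧ (∀ i, min a b ≤ i → σ i = 0) ∧
    M = U * svdDiag b a σ * Vᵀ

lemma ode_zero {a b r : ℕ} (α η s : ℝ) (hα : 0 < α) (hη : 0 < η) (hs : 0 ≤ s)
    (M : Matrix (Fin b) (Fin a) ℝ) (u : Fin b → ℝ) (v : Fin a → ℝ)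
    (hMv : M *ᵥ v = s • u) (hMu : Mᵀ *ᵥ u = s • v)
    (A : ℝ → Matrix (Fin a) (Fin r) ℝ) (B : ℝ → Matrix (Fin b) (Fin r) ℝ)
    (hflow : LoraFlow α η η M A B)
    (hA0 : (A 0)ᵀ *ᵥ v = 0) (hB0 : (B 0)ᵀ *ᵥ u = 0) (t : ℝ) (ht : 0 ≤ t) :
    (A t)ᵀ *ᵥ v = 0 ∧ (B t)ᵀ *ᵥ u = 0 := by
  set c : ℝ := α / (r : ℝ) with hc
  have hc0 : 0 ≤ c := by positivity
  let E : ℝ → ℝ := fun t => ∑ k, (((A t)ᵀ *ᵥ v) k) ^ 2 + ∑ k, (((B t)ᵀ *ᵥ u) k) ^ 2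
  let p : ℝ → Fin r → ℝ := fun t => (A t)ᵀ *ᵥ v
  let q : ℝ → Fin r → ℝ := fun t => (B t)ᵀ *ᵥ u
  let K : ℝ := 2 * η * c * s
  have hE : ∀ t, 0 ≤ t → ∃ E', HasDerivAt E E' t ∧ E' ≤ K * E t := by
    intro t ht
    obtain ⟨h1, h2⟩ := hflow t ht
    have hp : ∀ k, HasDerivAt (fun s => p s k)
        ((((-η) • ((lG α M (A t) (B t))ᵀ * B t))ᵀ *ᵥ v) k) t := by
      intro k
      simp only [p, mulVec, dotProduct, transpose_apply]
      exact HasDerivAt.fun_sum fun j _ => (h1 j k).mul_const _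
    have hq : ∀ k, HasDerivAt (fun s => q s k)
        ((((-η) • (lG α M (A t) (B t) * A t))ᵀ *ᵥ u) k) t := by
      intro k
      simp only [q, mulVec, dotProduct, transpose_apply]
      exact HasDerivAt.fun_sum fun j _ => (h2 j k).mul_const _
    have e1 : ((-η) • ((lG α M (A t) (B t))ᵀ * B t))ᵀ *ᵥ v
        = (-η * c) • (c • ((B t)ᵀ *ᵥ (B t *ᵥ p t)) - s • q t) := by
      simp only [lG, lX, p, q, transpose_smul, transpose_mul, transpose_transpose, smul_mulVec,
        ← mulVec_mulVec, sub_mulVec, hMv, mulVec_sub, mulVec_smul, ← hc, smul_smul]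
    have e2 : ((-η) • (lG α M (A t) (B t) * A t))ᵀ *ᵥ u
        = (-η * c) • (c • ((A t)ᵀ *ᵥ (A t *ᵥ q t)) - s • p t) := by
      simp only [lG, lX, p, q, transpose_smul, transpose_mul, transpose_transpose, smul_mulVec,
        ← mulVec_mulVec, sub_mulVec, hMu, mulVec_sub, mulVec_smul, ← hc, smul_smul, transpose_sub]
    have hd := (HasDerivAt.fun_sum (u := Finset.univ) fun k _ => (hp k).fun_pow 2).add
      (HasDerivAt.fun_sum (u := Finset.univ) fun k _ => (hq k).fun_pow 2)
    refine ⟨_, hd, ?_⟩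
    rw [e1, e2]
    have f1 : ∀ w z : Fin r → ℝ, ∑ k, ((2:ℕ):ℝ) * w k ^ (2-1) * z k = 2 * (w ⬝ᵥ z) := by
      intro w z
      simp [dotProduct, Finset.mul_sum, mul_assoc]
    rw [f1, f1]
    have g1 : p t ⬝ᵥ ((B t)ᵀ *ᵥ (B t *ᵥ p t)) = (B t *ᵥ p t) ⬝ᵥ (B t *ᵥ p t) := by
      rw [dotProduct_mulVec, vecMul_transpose]
    have g2 : q t ⬝ᵥ ((A t)ᵀ *ᵥ (A t *ᵥ q t)) = (A t *ᵥ q t) ⬝ᵥ (A t *ᵥ q t) := by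
      rw [dotProduct_mulVec, vecMul_transpose]
    have g3 : 0 ≤ (B t *ᵥ p t) ⬝ᵥ (B t *ᵥ p t) :=
      Finset.sum_nonneg fun _ _ => mul_self_nonneg _
    have g4 : 0 ≤ (A t *ᵥ q t) ⬝ᵥ (A t *ᵥ q t) :=
      Finset.sum_nonneg fun _ _ => mul_self_nonneg _
    have g5 : 2 * (p t ⬝ᵥ q t) ≤ E t := by
      simp only [E, dotProduct, Finset.mul_sum, ← Finset.sum_add_distrib]
      refine Finset.sum_le_sum fun k _ => ?_
      change 2 * (p t k * q t k) ≤ p t k ^ 2 + q t k ^ 2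
      nlinarith [sq_nonneg (p t k - q t k)]
    simp only [dotProduct_smul, dotProduct_sub, g1, g2, smul_eq_mul, dotProduct_comm (q t) (p t)]
    have h1 : 0 ≤ η * c * c := by positivity
    have h2 : 0 ≤ 2 * η * c * s := by positivity
    have k1 := mul_nonneg h1 g3
    have k2 := mul_nonneg h1 g4
    have k3 := mul_le_mul_of_nonneg_left g5 h2
    simp only [K]
    nlinarith
  have hE0 : E 0 = 0 := by simp [E, hA0, hB0]
  have hanti : AntitoneOn (fun t => E t * Real.exp (-K * t)) (Set.Ici 0) := by
    have hF : ∀ t, 0 ≤ t → ∃ F', HasDerivAt (fun t => E t * Real.exp (-K * t)) F' t ∧ F' ≤ 0 := by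
      intro t ht
      obtain ⟨E', h, hle⟩ := hE t ht
      have hx : HasDerivAt (fun t => Real.exp (-K * t)) (Real.exp (-K * t) * (-K)) t := by
        have := ((hasDerivAt_id t).const_mul (-K)).exp
        simpa using this
      refine ⟨_, h.mul hx, ?_⟩
      have := Real.exp_pos (-K * t)
      nlinarith
    apply antitoneOn_of_deriv_nonpos (convex_Ici 0)
    · intro t ht
      obtain ⟨F', h, _⟩ := hF t ht
      exact h.continuousAt.continuousWithinAt
    · intro t ht
      rw [interior_Ici] at ht
      obtain ⟨F', h, _⟩ := hF t (le_of_lt ht)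
      exact h.differentiableAt.differentiableWithinAt
    · intro t ht
      rw [interior_Ici] at ht
      obtain ⟨F', h, h'⟩ := hF t (le_of_lt ht)
      rw [h.deriv]; exact h'
  have hle := hanti (Set.mem_Ici.2 le_rfl) (Set.mem_Ici.2 ht) ht
  simp only [hE0, zero_mul] at hle
  have hEt : E t ≤ 0 := by
    by_contra hcon
    push Not at hcon
    have := mul_pos hcon (Real.exp_pos (-K * t))
    linarith
  have n1 : 0 ≤ ∑ k, (((A t)ᵀ *ᵥ v) k) ^ 2 := Finset.sum_nonneg fun _ _ => sq_nonneg _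
  have n2 : 0 ≤ ∑ k, (((B t)ᵀ *ᵥ u) k) ^ 2 := Finset.sum_nonneg fun _ _ => sq_nonneg _
  simp only [E] at hEt
  have z1 : ∑ k, (((A t)ᵀ *ᵥ v) k) ^ 2 = 0 := by linarith
  have z2 : ∑ k, (((B t)ᵀ *ᵥ u) k) ^ 2 = 0 := by linarith
  rw [Finset.sum_eq_zero_iff_of_nonneg (fun _ _ => sq_nonneg _)] at z1 z2
  exact ⟨funext fun k => by simpa using z1 k (Finset.mem_univ _),
    funext fun k => by simpa using z2 k (Finset.mem_univ _)⟩

/-- sum of squared norms of the projections of the standard basis. -/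
lemma sum_proj {b : ℕ} (S : Submodule ℝ (EuclideanSpace ℝ (Fin b))) :
    ∑ j, ‖S.starProjection (EuclideanSpace.single j (1:ℝ))‖ ^ 2 = Module.finrank ℝ S := by
  let f := stdOrthonormalBasis ℝ S
  let e := EuclideanSpace.basisFun (Fin b) ℝ
  have h : ∀ j, ‖S.starProjection (EuclideanSpace.single j (1:ℝ))‖ ^ 2
      = ∑ l, (inner ℝ (e j) (f l : EuclideanSpace ℝ (Fin b))) ^ 2 := by
    intro j
    rw [Submodule.starProjection_apply, ← Submodule.coe_norm, ← f.sum_sq_norm_inner_right]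
    refine Finset.sum_congr rfl fun l _ => ?_
    rw [Submodule.coe_inner, ← Submodule.starProjection_apply,
      ← Submodule.inner_starProjection_left_eq_right,
      Submodule.starProjection_eq_self_iff.2 (f l).2, Real.norm_eq_abs, sq_abs, real_inner_comm]
    simp [e]
  simp only [h]
  rw [Finset.sum_comm]
  have : ∀ l, ∑ j, (inner ℝ (e j) (f l : EuclideanSpace ℝ (Fin b))) ^ 2 = 1 := by
    intro l
    have h1 := e.sum_sq_norm_inner_right (f l : EuclideanSpace ℝ (Fin b))
    simp only [Real.norm_eq_abs, sq_abs] at h1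
    rw [h1, ← Submodule.coe_norm, f.orthonormal.1 l, one_pow]
  simp [this]

lemma eckart_young {a b k : ℕ} (σ : ℕ → ℝ) (hσ : ∀ i j, i ≤ j → σ j ≤ σ i) (h0 : ∀ i, 0 ≤ σ i)
    (D : Matrix (Fin b) (Fin a) ℝ) (hD : D.rank ≤ k) :
    ∑ j ∈ Finset.Ico k (min a b), σ j ^ 2 ≤ fnormSq (D - svdDiag b a σ) := by
  let col : Fin a → EuclideanSpace ℝ (Fin b) := fun q => WithLp.toLp 2 (fun p => D p q)
  let S : Submodule ℝ (EuclideanSpace ℝ (Fin b)) := Submodule.span ℝ (Set.range col)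
  have hS : Module.finrank ℝ S ≤ k := by
    refine le_trans (le_of_eq ?_) hD
    rw [Matrix.rank_eq_finrank_span_cols]
    have : S = (Submodule.span ℝ (Set.range D.col)).map
        ((WithLp.linearEquiv 2 ℝ (Fin b → ℝ)).symm : (Fin b → ℝ) →ₗ[ℝ] EuclideanSpace ℝ (Fin b)) := by
      rw [Submodule.map_span, ← Set.range_comp]
      rfl
    rw [this]
    exact LinearEquiv.finrank_map_eq _ _
  let w : ℕ → ℝ := fun j => if h : j < b then
    ‖S.starProjection (EuclideanSpace.single (⟨j, h⟩ : Fin b) (1:ℝ))‖ ^ 2 else 0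
  have w0 : ∀ j, 0 ≤ w j := by
    intro j; simp only [w]; split_ifs <;> positivity
  have w1 : ∀ j, w j ≤ 1 := by
    intro j; simp only [w]; split_ifs with h
    · have := S.norm_starProjection_apply_le (EuclideanSpace.single (⟨j, h⟩ : Fin b) (1:ℝ))
      simp at this
      exact pow_le_one₀ (norm_nonneg _) this
    · exact zero_le_one
  have wsum : ∑ j ∈ Finset.range b, w j ≤ k := by
    rw [Finset.sum_range]
    have : ∀ j : Fin b, w j = ‖S.starProjection (EuclideanSpace.single j (1:ℝ))‖ ^ 2 := by
      intro j; simp [w]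
    simp only [this, sum_proj]
    exact_mod_cast hS
  set m := min a b with hm
  have wsum' : ∑ j ∈ Finset.range m, w j ≤ k :=
    (Finset.sum_le_sum_of_subset_of_nonneg
      (Finset.range_subset_range.2 (min_le_right a b)) fun j _ _ => w0 j).trans wsum
  -- column bound
  have hcol : ∑ j ∈ Finset.range m, σ j ^ 2 * (1 - w j) ≤ fnormSq (D - svdDiag b a σ) := by
    unfold fnormSq
    rw [Finset.sum_comm]
    let g : ℕ → ℝ := fun j => if h : j < a then ∑ p, (D - svdDiag b a σ) p ⟨j, h⟩ ^ 2 else 0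
    have hg : ∑ q, ∑ p, (D - svdDiag b a σ) p q ^ 2 = ∑ j ∈ Finset.range a, g j := by
      rw [Finset.sum_range]; simp [g]
    rw [hg]
    refine le_trans ?_ (Finset.sum_le_sum_of_subset_of_nonneg
      (Finset.range_subset_range.2 (min_le_left a b)) fun j _ _ => ?_)
    · refine Finset.sum_le_sum fun j hj => ?_
      rw [Finset.mem_range, hm, lt_min_iff] at hj
      obtain ⟨ha, hb⟩ := hj
      simp only [g, w, ha, hb, dite_true]
      set e : EuclideanSpace ℝ (Fin b) := EuclideanSpace.single (⟨j, hb⟩ : Fin b) (1:ℝ) with he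
      have hx : col ⟨j, ha⟩ ∈ S := Submodule.subset_span ⟨_, rfl⟩
      have e1 : ∑ p, (D - svdDiag b a σ) p ⟨j, ha⟩ ^ 2 = ‖col ⟨j, ha⟩ - σ j • e‖ ^ 2 := by
        rw [EuclideanSpace.real_norm_sq_eq]
        refine Finset.sum_congr rfl fun p _ => ?_
        congr 1
        simp only [col, e, svdDiag, Matrix.sub_apply, Matrix.of_apply, PiLp.sub_apply,
          PiLp.smul_apply, smul_eq_mul, PiLp.single_apply, Fin.ext_iff]
        split_ifs with h <;> simp [h]
      rw [e1]
      set x := col ⟨j, ha⟩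
      have e2 := S.norm_sq_eq_add_norm_sq_starProjection (x - σ j • e)
      have e3 := S.norm_sq_eq_add_norm_sq_starProjection e
      have e4 : ‖Sᗮ.starProjection (x - σ j • e)‖ ^ 2 = σ j ^ 2 * ‖Sᗮ.starProjection e‖ ^ 2 := by
        rw [map_sub, map_smul, Submodule.starProjection_orthogonal_apply_eq_zero hx]
        simp [norm_smul, mul_pow]
      have e5 : ‖e‖ = 1 := by simp [e]
      rw [e5] at e3
      have e6 : (1:ℝ) - ‖S.starProjection e‖ ^ 2 = ‖Sᗮ.starProjection e‖ ^ 2 := by linarith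
      rw [e6, ← e4, e2]
      nlinarith [sq_nonneg ‖S.starProjection (x - σ j • e)‖]
    · simp only [g]; split_ifs
      · exact Finset.sum_nonneg fun _ _ => sq_nonneg _
      · exact le_rfl
  refine le_trans ?_ hcol
  rcases le_total m k with hmk | hkm
  · rw [Finset.Ico_eq_empty_of_le hmk, Finset.sum_empty]
    exact Finset.sum_nonneg fun j _ => mul_nonneg (sq_nonneg _) (by linarith [w1 j])
  · rw [← Finset.sum_range_add_sum_Ico _ hkm]
    rw [← Finset.sum_range_add_sum_Ico _ hkm] at wsum'
    have a1 : ∑ j ∈ Finset.range k, σ k ^ 2 * (1 - w j) ≤ ∑ j ∈ Finset.range k, σ j ^ 2 * (1 - w j) := by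
      refine Finset.sum_le_sum fun j hj => mul_le_mul_of_nonneg_right ?_ (by linarith [w1 j])
      exact pow_le_pow_left₀ (h0 _) (hσ _ _ (Finset.mem_range.1 hj).le) 2
    have a2 : ∑ j ∈ Finset.Ico k m, (σ j ^ 2 - σ k ^ 2 * w j) ≤ ∑ j ∈ Finset.Ico k m, σ j ^ 2 * (1 - w j) := by
      refine Finset.sum_le_sum fun j hj => ?_
      have := mul_le_mul_of_nonneg_right
        (pow_le_pow_left₀ (h0 _) (hσ _ _ (Finset.mem_Ico.1 hj).1) 2) (w0 j)
      linarith
    rw [← Finset.mul_sum, Finset.sum_sub_distrib, Finset.sum_const, Finset.card_range] at a1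
    rw [Finset.sum_sub_distrib, ← Finset.mul_sum] at a2
    simp only [nsmul_eq_mul, mul_one] at a1
    have := mul_le_mul_of_nonneg_left wsum' (sq_nonneg (σ k))
    nlinarith

lemma fnormSq_eq_trace {m n : ℕ} (Z : Matrix (Fin m) (Fin n) ℝ) : fnormSq Z = (Zᵀ * Z).trace := by
  simp only [fnormSq, trace, diag, mul_apply, transpose_apply, sq]
  exact Finset.sum_comm

lemma fnormSq_orth {m n : ℕ} (U : Matrix (Fin m) (Fin m) ℝ) (V : Matrix (Fin n) (Fin n) ℝ)
    (hU : U * Uᵀ = 1) (hV : V * Vᵀ = 1) (Z : Matrix (Fin m) (Fin n) ℝ) :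
    fnormSq (Uᵀ * Z * V) = fnormSq Z := by
  rw [fnormSq_eq_trace, fnormSq_eq_trace, trace_mul_comm]
  have : Uᵀ * Z * V * (Uᵀ * Z * V)ᵀ = Uᵀ * (Z * Zᵀ) * U := by
    simp only [transpose_mul, transpose_transpose, Matrix.mul_assoc]
    rw [← Matrix.mul_assoc V, hV, Matrix.one_mul]
  rw [this, trace_mul_comm, ← Matrix.mul_assoc, hU, Matrix.one_mul, trace_mul_comm]

lemma mat_rank_add_le {m n : ℕ} (P Q : Matrix (Fin m) (Fin n) ℝ) :
    (P + Q).rank ≤ P.rank + Q.rank := by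
  unfold Matrix.rank
  rw [Matrix.mulVecLin_add]
  exact (Submodule.finrank_mono (LinearMap.range_add_le _ _)).trans
    (Submodule.finrank_add_le_finrank_add_finrank _ _)

/-- For classic LoRA gradient flow (`ηA = ηB = η`), if for some `i < r`
(`0`-based, i.e. `i ≤ r` in `1`-based counting) the initialization is orthogonal to the
`i`-th singular direction of `M`, i.e. `A₀ᵀ vᵢ(M) = 0` and `B₀ᵀ uᵢ(M) = 0`, then for all
`t ≥ 0` we have `Xₜ vᵢ(M) = 0` and `uᵢ(M)ᵀ Xₜ = 0`; consequently, if moreover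
`σᵢ(M) > σ_{r+1}(M)` (in `0`-based indexing, `σ i > σ r`) then
`Lₜ - L* ≥ (1/2)(σᵢ(M)² - σ_{r+1}(M)²) > 0` for all `t ≥ 0`. -/
theorem statement1
    (a b r : ℕ) (hr0 : 0 < r) (hr : r ≤ min a b)
    (α η : ℝ) (hα : 0 < α) (hη : 0 < η)
    (M : Matrix (Fin b) (Fin a) ℝ)
    (UM : Matrix (Fin b) (Fin b) ℝ) (VM : Matrix (Fin a) (Fin a) ℝ) (σ : ℕ → ℝ)
    (hsvd : IsSVD M UM VM σ)
    (i : ℕ) (hi : i < r)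
    (A : ℝ → Matrix (Fin a) (Fin r) ℝ) (B : ℝ → Matrix (Fin b) (Fin r) ℝ)
    (hflow : LoraFlow α η η M A B)
    (hA0 : (A 0)ᵀ *ᵥ (fun j => VM j ⟨i, hi.trans_le (hr.trans (min_le_left a b))⟩) = 0)
    (hB0 : (B 0)ᵀ *ᵥ (fun j => UM j ⟨i, hi.trans_le (hr.trans (min_le_right a b))⟩) = 0) :
    (∀ t, (0:ℝ) ≤ t →
      lX α (A t) (B t) *ᵥ (fun j => VM j ⟨i, hi.trans_le (hr.trans (min_le_left a b))⟩) = 0 ∧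
      (fun j => UM j ⟨i, hi.trans_le (hr.trans (min_le_right a b))⟩) ᵥ* lX α (A t) (B t) = 0) ∧
    (σ r < σ i →
      0 < (1 / 2) * (σ i ^ 2 - σ r ^ 2) ∧
      ∀ t, (0:ℝ) ≤ t →
        (1 / 2) * (σ i ^ 2 - σ r ^ 2) ≤
          (1 / 2) * fnormSq (lX α (A t) (B t) - M) -
            (1 / 2) * ∑ j ∈ Finset.Ico r (min a b), σ j ^ 2) := by
  obtain ⟨hU1, hU2, hV1, hV2, hσ, h0, hz, hM⟩ := hsvd
  have hia : i < a := hi.trans_le (hr.trans (min_le_left a b))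
  have hib : i < b := hi.trans_le (hr.trans (min_le_right a b))
  have hv : (fun j => VM j ⟨i, hia⟩) = VM *ᵥ Pi.single ⟨i, hia⟩ 1 := by
    ext j; simp
  have hu : (fun j => UM j ⟨i, hib⟩) = UM *ᵥ Pi.single ⟨i, hib⟩ 1 := by
    ext j; simp
  have hMv : M *ᵥ (fun j => VM j ⟨i, hia⟩) = σ i • (fun j => UM j ⟨i, hib⟩) := by
    rw [hv, hu, hM, mulVec_mulVec, Matrix.mul_assoc, hV2, Matrix.mul_one, ← mulVec_mulVec,
      ← mulVec_smul]
    congr 1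
    ext p
    simp [svdDiag, Pi.single_apply, Fin.ext_iff]
    split_ifs with h
    · rw [h]
    · rfl
  have hMu : Mᵀ *ᵥ (fun j => UM j ⟨i, hib⟩) = σ i • (fun j => VM j ⟨i, hia⟩) := by
    rw [hv, hu, hM, mulVec_mulVec, transpose_mul, transpose_mul, transpose_transpose,
      Matrix.mul_assoc, Matrix.mul_assoc, hU2, Matrix.mul_one, ← mulVec_mulVec,
      ← mulVec_smul]
    congr 1
    ext p
    simp [svdDiag, Pi.single_apply, Fin.ext_iff, eq_comm]
  have key : ∀ t, (0:ℝ) ≤ t →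
      lX α (A t) (B t) *ᵥ (fun j => VM j ⟨i, hia⟩) = 0 ∧
      (fun j => UM j ⟨i, hib⟩) ᵥ* lX α (A t) (B t) = 0 := by
    intro t ht
    obtain ⟨h1, h2⟩ := ode_zero α η (σ i) hα hη (h0 i) M _ _ hMv hMu A B hflow hA0 hB0 t ht
    constructor
    · rw [lX, smul_mulVec, ← mulVec_mulVec, h1, mulVec_zero, smul_zero]
    · rw [lX, vecMul_smul, ← vecMul_vecMul, ← mulVec_transpose (B t), h2, zero_vecMul, smul_zero]
  refine ⟨key, fun hlt => ⟨?_, fun t ht => ?_⟩⟩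
  · have := h0 r
    nlinarith
  obtain ⟨k1, k2⟩ := key t ht
  set X := lX α (A t) (B t) with hX
  let D := UMᵀ * X * VM
  have hDM : UMᵀ * (X - M) * VM = D - svdDiag b a σ := by
    rw [Matrix.mul_sub, Matrix.sub_mul]
    congr 1
    rw [hM, Matrix.mul_assoc UM, ← Matrix.mul_assoc UMᵀ, hU2, Matrix.one_mul, Matrix.mul_assoc, hV2,
      Matrix.mul_one]
  have hXrank : X.rank ≤ r := by
    rw [hX, lX, ← Matrix.smul_mul]
    refine (rank_mul_le_left _ _).trans ?_
    simpa using rank_le_width ((α / (r:ℝ)) • B t)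
  have hDrank : D.rank ≤ r := (rank_mul_le_left _ _).trans ((rank_mul_le_right _ _).trans hXrank)
  have hcol0 : ∀ p, D p ⟨i, hia⟩ = 0 := by
    intro p
    have : D *ᵥ Pi.single ⟨i, hia⟩ 1 = 0 := by
      simp only [D]
      rw [← mulVec_mulVec, ← hv, ← mulVec_mulVec, k1, mulVec_zero]
    simpa using congrFun this p
  have hrow0 : ∀ q, D ⟨i, hib⟩ q = 0 := by
    intro q
    have : Pi.single ⟨i, hib⟩ 1 ᵥ* D = 0 := by
      simp only [D]
      rw [← vecMul_vecMul, ← vecMul_vecMul, vecMul_transpose, ← hu, k2, zero_vecMul]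
    simpa using congrFun this q
  let F : Matrix (Fin b) (Fin a) ℝ := Matrix.single ⟨i, hib⟩ ⟨i, hia⟩ (σ i)
  have hFrank : F.rank ≤ 1 := by
    have : F = Matrix.vecMulVec (Pi.single ⟨i, hib⟩ (σ i)) (Pi.single ⟨i, hia⟩ 1) := by
      ext p q
      simp [F, Matrix.single_apply, vecMulVec_apply, Pi.single_apply, ite_and, eq_comm]
      split_ifs <;> rfl
    rw [this]
    exact rank_vecMulVec_le _ _
  have hey := eckart_young (k := r + 1) σ hσ h0 (D + F)
    ((mat_rank_add_le _ _).trans (add_le_add hDrank hFrank))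
  have hsplit : fnormSq (D - svdDiag b a σ) = fnormSq (D + F - svdDiag b a σ) + σ i ^ 2 := by
    have : σ i ^ 2 = ∑ p : Fin b, ∑ q : Fin a, if p = ⟨i, hib⟩ ∧ q = ⟨i, hia⟩ then σ i ^ 2 else 0 := by
      simp [ite_and]
    rw [this]
    simp only [fnormSq, ← Finset.sum_add_distrib]
    refine Finset.sum_congr rfl fun p _ => Finset.sum_congr rfl fun q _ => ?_
    by_cases h : p = ⟨i, hib⟩ ∧ q = ⟨i, hia⟩
    · obtain ⟨rfl, rfl⟩ := h
      simp [F, svdDiag, hcol0]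
    · have : F p q = 0 := by
        simp only [F, Matrix.single_apply]
        rw [if_neg]
        rintro ⟨rfl, rfl⟩; exact h ⟨rfl, rfl⟩
      simp [h, this]
  rw [← fnormSq_orth UM VM hU1 hV1 (X - M), hDM, hsplit]
  have hs : ∑ j ∈ Finset.Ico r (min a b), σ j ^ 2
      ≤ σ r ^ 2 + ∑ j ∈ Finset.Ico (r + 1) (min a b), σ j ^ 2 := by
    rcases hr.lt_or_eq with h | h
    · rw [Finset.sum_eq_sum_Ico_succ_bot h]
    · rw [← h]; simp; positivity
  linarith

end
end

section
/- Let g : ℝ^{b×a} → ℝ^{b×a} satisfy ‖g(X)‖_F ≤ R for all X, and consider the classic LoRA flow dA_t/dt = −η g(X_t)ᵀ B_t, dB_t/dt = −η g(X_t) A_t under zero+random initialization (A_0 = 0 or B_0 = 0). Then for all t ≥ 0, ‖Y_t − Y_0‖_F + ‖Z_t − Z_0‖_F ≤ 2(‖Y_0‖_F + ‖Z_0‖_F)·(e^{2ηR√r t} − 1)². -/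
open Matrix MeasureTheory Filter Topology

noncomputable section

section helpers

attribute [local instance] Matrix.frobeniusNormedAddCommGroup Matrix.frobeniusNormedSpace

theorem fnorm_eq_norm {m n : ℕ} (M : Matrix (Fin m) (Fin n) ℝ) : fnorm M = ‖M‖ := by
  rw [frobenius_norm_def, fnorm, fnormSq, Real.sqrt_eq_rpow]; simp

theorem hasDerivAt_mul_transpose {m n r : ℕ} (c : ℝ)
    {P : ℝ → Matrix (Fin m) (Fin r) ℝ} {Q : ℝ → Matrix (Fin n) (Fin r) ℝ}
    {P' : Matrix (Fin m) (Fin r) ℝ} {Q' : Matrix (Fin n) (Fin r) ℝ} {t : ℝ}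
    (hP : ∀ i j, HasDerivAt (fun s => P s i j) (P' i j) t)
    (hQ : ∀ i j, HasDerivAt (fun s => Q s i j) (Q' i j) t) :
    HasDerivAt (fun s => c • (P s * (Q s)ᵀ)) (c • (P' * (Q t)ᵀ + P t * Q'ᵀ)) t := by
  refine hasDerivAt_pi.2 fun i => hasDerivAt_pi.2 fun j => ?_
  have h : HasDerivAt (fun s => c * ∑ k, P s i k * Q s j k)
      (c * ∑ k, (P' i k * Q t j k + P t i k * Q' j k)) t :=
    (HasDerivAt.fun_sum fun k _ => (hP i k).mul (hQ j k)).const_mul c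
  simpa [Matrix.mul_apply, Finset.sum_add_distrib] using h

theorem norm_comb_le {p q s u : ℕ} (η R x y : ℝ) (hη : 0 < η)
    (G : Matrix (Fin p) (Fin q) ℝ) (M : Matrix (Fin q) (Fin s) ℝ)
    (M₂ : Matrix (Fin p) (Fin u) ℝ) (G₂ : Matrix (Fin u) (Fin s) ℝ)
    (hG : ‖G‖ ≤ R) (hG₂ : ‖G₂‖ ≤ R) (hM : ‖M‖ ≤ x) (hM₂ : ‖M₂‖ ≤ y) :
    ‖(-η) • (G * M + M₂ * G₂)‖ ≤ η * R * (x + y) := by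
  have hR : 0 ≤ R := (norm_nonneg G).trans hG
  have h1 : ‖G * M‖ ≤ R * x := (frobenius_norm_mul G M).trans (by gcongr)
  have hy : 0 ≤ y := (norm_nonneg M₂).trans hM₂
  have h2 : ‖M₂ * G₂‖ ≤ y * R := (frobenius_norm_mul M₂ G₂).trans (by gcongr)
  have h3 := norm_add_le (G * M) (M₂ * G₂)
  rw [norm_smul, norm_neg, Real.norm_of_nonneg hη.le]
  calc η * ‖G * M + M₂ * G₂‖ ≤ η * (R * x + y * R) := by gcongr; linarith
    _ = _ := by ring

theorem exp_aux (u : ℝ) : Real.exp u - 1 - u ≤ (Real.exp u - 1) ^ 2 ∨ u < 0 := by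
  by_cases hu : u < 0
  · exact Or.inr hu
  left
  have hu : 0 ≤ u := not_lt.1 hu
  have h1 : 1 ≤ Real.exp u := Real.one_le_exp hu
  have h2 := Real.add_one_le_exp (-u)
  rw [Real.exp_neg] at h2
  have h3 : (Real.exp u)⁻¹ * Real.exp u = 1 := inv_mul_cancel₀ (by positivity)
  have h4 : (Real.exp u)⁻¹ ≤ 1 := inv_le_one_of_one_le₀ h1
  have : Real.exp u + (Real.exp u)⁻¹ - 2 = (Real.exp u)⁻¹ * (Real.exp u - 1) ^ 2 := by
    linear_combination (2 - Real.exp u) * h3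
  have h5 : (Real.exp u)⁻¹ * (Real.exp u - 1) ^ 2 ≤ 1 * (Real.exp u - 1) ^ 2 := by gcongr
  linarith

theorem core {a b : ℕ} (η R N : ℝ) (hη : 0 < η) (hR : 0 ≤ R)
    (g : ℝ → Matrix (Fin b) (Fin a) ℝ) (hg : ∀ t, ‖g t‖ ≤ R)
    (X : ℝ → Matrix (Fin b) (Fin a) ℝ) (Y : ℝ → Matrix (Fin a) (Fin a) ℝ)
    (Z : ℝ → Matrix (Fin b) (Fin b) ℝ)
    (hX : ∀ t, 0 ≤ t → HasDerivAt X ((-η) • (g t * Y t + Z t * g t)) t)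
    (hY : ∀ t, 0 ≤ t → HasDerivAt Y ((-η) • ((g t)ᵀ * X t + (X t)ᵀ * g t)) t)
    (hZ : ∀ t, 0 ≤ t → HasDerivAt Z ((-η) • (g t * (X t)ᵀ + X t * (g t)ᵀ)) t)
    (hX0 : X 0 = 0) (hY0 : ‖Y 0‖ ≤ N) (hZ0 : ‖Z 0‖ ≤ N) (t : ℝ) (ht : 0 ≤ t) :
    ‖Y t - Y 0‖ + ‖Z t - Z 0‖ ≤
      2 * N * (Real.exp (2 * η * R * t) - 1 - 2 * η * R * t) := by
  have hN : 0 ≤ N := (norm_nonneg _).trans hY0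
  have hgT : ∀ t, ‖(g t)ᵀ‖ ≤ R := fun t => by rw [frobenius_norm_transpose]; exact hg t
  have hXT : ∀ t, ‖(X t)ᵀ‖ = ‖X t‖ := fun t => frobenius_norm_transpose _
  set k := 2 * η * R with hk
  have hE : ∀ s, HasDerivAt (fun s => Real.exp (k * s)) (k * Real.exp (k * s)) s := fun s => by
    have := ((hasDerivAt_id s).const_mul k).exp
    simpa [mul_comm] using this
  -- crude Gronwall bound
  have hW : ∀ t, 0 ≤ t → ‖(X t, Y t, Z t)‖ ≤ N * Real.exp (k * t) := by
    intro t ht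
    have hd := fun s (hs : 0 ≤ s) => (hX s hs).prodMk ((hY s hs).prodMk (hZ s hs))
    have := norm_le_gronwallBound_of_norm_deriv_right_le (f := fun t => (X t, Y t, Z t))
      (δ := N) (K := k) (ε := 0) (a := 0) (b := t)
      (fun s hs => (hd s hs.1).continuousAt.continuousWithinAt)
      (fun s hs => (hd s hs.1).hasDerivWithinAt) ?_ ?_ t ⟨ht, le_rfl⟩
    · simpa [gronwallBound_ε0] using this
    · simp [Prod.norm_mk, hX0, hN, hY0, hZ0]
    · intro s hs
      have e1 : ‖X s‖ ≤ ‖(X s, Y s, Z s)‖ := norm_fst_le (X s, Y s, Z s)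
      have e : ‖(Y s, Z s)‖ ≤ ‖(X s, Y s, Z s)‖ := norm_snd_le (X s, Y s, Z s)
      have e2 : ‖Y s‖ ≤ ‖(X s, Y s, Z s)‖ := (norm_fst_le (Y s, Z s)).trans e
      have e3 : ‖Z s‖ ≤ ‖(X s, Y s, Z s)‖ := (norm_snd_le (Y s, Z s)).trans e
      generalize ‖(X s, Y s, Z s)‖ = w at *
      have r : η * R * (w + w) = k * w + 0 := by rw [hk]; ring
      rw [← r]
      refine norm_prod_le_iff.2 ⟨?_, norm_prod_le_iff.2 ⟨?_, ?_⟩⟩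
      · exact norm_comb_le η R w w hη _ _ _ _ (hg s) (hg s) e2 e3
      · exact norm_comb_le η R w w hη _ _ _ _ (hgT s) (hg s) e1 ((hXT s).trans_le e1)
      · exact norm_comb_le η R w w hη _ _ _ _ (hg s) (hgT s) ((hXT s).trans_le e1) e1
  have hXb : ∀ t, 0 ≤ t → ‖X t‖ ≤ N * (Real.exp (k * t) - 1) := by
    intro t ht
    refine image_norm_le_of_norm_deriv_right_le_deriv_boundary (f := X) (a := 0) (b := t)
      (fun s hs => (hX s hs.1).continuousAt.continuousWithinAt)
      (fun s hs => (hX s hs.1).hasDerivWithinAt)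
      (B := fun s => N * (Real.exp (k * s) - 1)) (B' := fun s => N * (k * Real.exp (k * s)))
      ?_ (fun s => ((hE s).sub_const 1).const_mul N) ?_ ⟨ht, le_rfl⟩
    · simp [hX0]
    · intro s hs
      have e : ‖(Y s, Z s)‖ ≤ ‖(X s, Y s, Z s)‖ := norm_snd_le (X s, Y s, Z s)
      have e2 : ‖Y s‖ ≤ _ := ((norm_fst_le (Y s, Z s)).trans e).trans (hW s hs.1)
      have e3 : ‖Z s‖ ≤ _ := ((norm_snd_le (Y s, Z s)).trans e).trans (hW s hs.1)
      refine (norm_comb_le η R _ _ hη _ _ _ _ (hg s) (hg s) e2 e3).trans (le_of_eq ?_)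
      rw [hk]; ring
  have hF : ∀ s, HasDerivAt (fun s => N * (Real.exp (k * s) - 1 - k * s))
      (N * (k * Real.exp (k * s) - k)) s := fun s => by
    have := (((hE s).sub_const 1).sub ((hasDerivAt_id s).const_mul k)).const_mul N
    simpa using this
  have hYb : ‖Y t - Y 0‖ ≤ N * (Real.exp (k * t) - 1 - k * t) := by
    refine image_norm_le_of_norm_deriv_right_le_deriv_boundary (f := fun s => Y s - Y 0)
      (a := 0) (b := t)
      (fun s hs => ((hY s hs.1).sub_const (Y 0)).continuousAt.continuousWithinAt)
      (fun s hs => ((hY s hs.1).sub_const (Y 0)).hasDerivWithinAt)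
      (B := fun s => N * (Real.exp (k * s) - 1 - k * s))
      (B' := fun s => N * (k * Real.exp (k * s) - k)) ?_ hF ?_ ⟨ht, le_rfl⟩
    · simp
    · intro s hs
      have e1 := hXb s hs.1
      refine (norm_comb_le η R _ _ hη _ _ _ _ (hgT s) (hg s) e1
        ((hXT s).trans_le e1)).trans (le_of_eq ?_)
      rw [hk]; ring
  have hZb : ‖Z t - Z 0‖ ≤ N * (Real.exp (k * t) - 1 - k * t) := by
    refine image_norm_le_of_norm_deriv_right_le_deriv_boundary (f := fun s => Z s - Z 0)
      (a := 0) (b := t)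
      (fun s hs => ((hZ s hs.1).sub_const (Z 0)).continuousAt.continuousWithinAt)
      (fun s hs => ((hZ s hs.1).sub_const (Z 0)).hasDerivWithinAt)
      (B := fun s => N * (Real.exp (k * s) - 1 - k * s))
      (B' := fun s => N * (k * Real.exp (k * s) - k)) ?_ hF ?_ ⟨ht, le_rfl⟩
    · simp
    · intro s hs
      have e1 := hXb s hs.1
      refine (norm_comb_le η R _ _ hη _ _ _ _ (hg s) (hgT s)
        ((hXT s).trans_le e1) e1).trans (le_of_eq ?_)
      rw [hk]; ring
  linarith

theorem main_aux
    (a b r : ℕ) (hr0 : 0 < r)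
    (α η R : ℝ) (hη : 0 < η)
    (g : Matrix (Fin b) (Fin a) ℝ → Matrix (Fin b) (Fin a) ℝ)
    (hgR : ∀ X, fnorm (g X) ≤ R)
    (A : ℝ → Matrix (Fin a) (Fin r) ℝ) (B : ℝ → Matrix (Fin b) (Fin r) ℝ)
    (hA : ∀ t, (0:ℝ) ≤ t → ∀ i j, HasDerivAt (fun s => A s i j)
      (((-η) • ((g (lX α (A t) (B t)))ᵀ * B t)) i j) t)
    (hB : ∀ t, (0:ℝ) ≤ t → ∀ i j, HasDerivAt (fun s => B s i j)
      (((-η) • (g (lX α (A t) (B t)) * A t)) i j) t)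
    (hinit : A 0 = 0 ∨ B 0 = 0) (t : ℝ) (ht : 0 ≤ t) :
      fnorm (lY α (A t) - lY α (A 0)) + fnorm (lZ α (B t) - lZ α (B 0)) ≤
        2 * (fnorm (lY α (A 0)) + fnorm (lZ α (B 0))) *
          (Real.exp (2 * η * R * Real.sqrt r * t) - 1) ^ 2 := by
  simp only [fnorm_eq_norm] at *
  have hR : 0 ≤ R := (norm_nonneg _).trans (hgR 0)
  have h := core η R (‖lY α (A 0)‖ + ‖lZ α (B 0)‖) hη hR
    (fun t => g (lX α (A t) (B t))) (fun t => hgR _)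
    (fun t => lX α (A t) (B t)) (fun t => lY α (A t)) (fun t => lZ α (B t))
    (fun t ht => by
      refine (hasDerivAt_mul_transpose (α / (r : ℝ)) (hB t ht) (hA t ht)).congr_deriv ?_
      generalize g (lX α (A t) (B t)) = G
      simp only [lY, lZ, Matrix.transpose_smul, Matrix.transpose_mul, Matrix.transpose_transpose,
        Matrix.smul_mul, Matrix.mul_smul, Matrix.mul_assoc, ← smul_add]
      rw [smul_comm])
    (fun t ht => by
      refine (hasDerivAt_mul_transpose (α / (r : ℝ)) (hA t ht) (hA t ht)).congr_deriv ?_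
      generalize g (lX α (A t) (B t)) = G
      simp only [lX, Matrix.transpose_smul, Matrix.transpose_mul, Matrix.transpose_transpose,
        Matrix.smul_mul, Matrix.mul_smul, Matrix.mul_assoc, ← smul_add]
      rw [smul_comm])
    (fun t ht => by
      refine (hasDerivAt_mul_transpose (α / (r : ℝ)) (hB t ht) (hB t ht)).congr_deriv ?_
      generalize g (lX α (A t) (B t)) = G
      simp only [lX, Matrix.transpose_smul, Matrix.transpose_mul, Matrix.transpose_transpose,
        Matrix.smul_mul, Matrix.mul_smul, Matrix.mul_assoc, ← smul_add]
      rw [smul_comm])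
    (by rcases hinit with h | h <;> simp [lX, h])
    (le_add_of_nonneg_right (norm_nonneg _)) (le_add_of_nonneg_left (norm_nonneg _)) t ht
  refine h.trans ?_
  have hu : 0 ≤ 2 * η * R * t := by positivity
  have h1 := (exp_aux (2 * η * R * t)).resolve_right (not_lt.2 hu)
  have hs : 1 ≤ Real.sqrt r := Real.one_le_sqrt.2 (by exact_mod_cast hr0)
  have hle : 2 * η * R * t ≤ 2 * η * R * Real.sqrt r * t := by
    have := mul_le_mul_of_nonneg_left hs hu
    linarith
  have h2 := Real.exp_le_exp.2 hle
  have h3 : 0 ≤ Real.exp (2 * η * R * t) - 1 := by linarith [Real.one_le_exp hu]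
  gcongr
  exact h1.trans (by gcongr)

end helpers

/-- Under a gradient calculator `g` bounded by `R` in Frobenius norm, the
classic LoRA flow with zero+random initialization (`A₀ = 0` or `B₀ = 0`) satisfies, for all
`t ≥ 0`, `‖Yₜ - Y₀‖_F + ‖Zₜ - Z₀‖_F ≤ 2(‖Y₀‖_F + ‖Z₀‖_F)(e^{2ηR√r t} - 1)²`. -/
theorem statement13
    (a b r : ℕ) (hr0 : 0 < r) (hr : r ≤ min a b)
    (α η R : ℝ) (hα : 0 < α) (hη : 0 < η)
    (g : Matrix (Fin b) (Fin a) ℝ → Matrix (Fin b) (Fin a) ℝ)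
    (hgR : ∀ X, fnorm (g X) ≤ R)
    (A : ℝ → Matrix (Fin a) (Fin r) ℝ) (B : ℝ → Matrix (Fin b) (Fin r) ℝ)
    (hA : ∀ t, (0:ℝ) ≤ t → ∀ i j, HasDerivAt (fun s => A s i j)
      (((-η) • ((g (lX α (A t) (B t)))ᵀ * B t)) i j) t)
    (hB : ∀ t, (0:ℝ) ≤ t → ∀ i j, HasDerivAt (fun s => B s i j)
      (((-η) • (g (lX α (A t) (B t)) * A t)) i j) t)
    (hinit : A 0 = 0 ∨ B 0 = 0) :
    ∀ t, (0:ℝ) ≤ t →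
      fnorm (lY α (A t) - lY α (A 0)) + fnorm (lZ α (B t) - lZ α (B 0)) ≤
        2 * (fnorm (lY α (A 0)) + fnorm (lZ α (B 0))) *
          (Real.exp (2 * η * R * Real.sqrt r * t) - 1) ^ 2 := by
  exact main_aux a b r hr0 α η R hη g hgR A B hA hB hinit

end
end
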